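/- arXiv:2311.04395 — 2 statements merged into one kernel-verified Lean document; each statement's English description precedes it below -/
import Mathlib

section
/- Let T be a real trigonometric polynomial of degree at most n that is nonnegative on ℝ. Then max_{τ ∈ ℝ} |T′(τ)| ≤ (n/2) · max_{τ ∈ ℝ} T(τ). -/
open Finset in
/-- The sum of `exp (i r t)` over the `2n` zeros `t` of `cos (n t)` in one period vanishes
for `0 < |r| < 2n`. -/
theorem sum_exp_nodes_eq_zero {n : ℕ} (hn : 0 < n) {r : ℤ} (hr : r ≠ 0) (hr' : |r| < 2 * n) :
    ∑ k ∈ range (2 * n),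
      Complex.exp (r * (((2 * k + 1) * Real.pi / (2 * n) : ℝ) : ℂ) * Complex.I) = 0 := by
  have hn' : (n : ℂ) ≠ 0 := by exact_mod_cast hn.ne'
  set ζ : ℂ := Complex.exp (r * Real.pi / n * Complex.I) with hζ
  have hterm : ∀ k : ℕ,
      Complex.exp (r * (((2 * k + 1) * Real.pi / (2 * n) : ℝ) : ℂ) * Complex.I) =
        Complex.exp (r * Real.pi / (2 * n) * Complex.I) * ζ ^ k := by
    intro k
    rw [hζ, ← Complex.exp_nat_mul, ← Complex.exp_add]
    congr 1
    push_cast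
    field_simp
    ring
  have hpow : ζ ^ (2 * n) = 1 := by
    rw [hζ, ← Complex.exp_nat_mul, Complex.exp_eq_one_iff]
    refine ⟨r, ?_⟩
    push_cast
    field_simp
  have hne : ζ ≠ 1 := by
    rw [hζ, Ne, Complex.exp_eq_one_iff]
    rintro ⟨m, hm⟩
    have hπ : (Real.pi : ℂ) ≠ 0 := by exact_mod_cast Real.pi_ne_zero
    have h : (r : ℂ) = m * (2 * n) := by
      field_simp at hm
      linear_combination hm
    have h' : r = m * (2 * n) := by exact_mod_cast h
    have hm0 : m ≠ 0 := by
      rintro rfl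
      simp at h'
      exact hr h'
    have := Int.one_le_abs hm0
    rw [h', abs_mul, abs_of_nonneg (by positivity : (0 : ℤ) ≤ 2 * n)] at hr'
    nlinarith
  simp_rw [hterm, ← mul_sum, geom_sum_eq hne, hpow]
  simp

open Finset in
/-- M. Riesz's interpolation formula for the derivative at `0` of `t ↦ exp (i j t)`. -/
theorem riesz_interpolation_exp {n j : ℕ} (hn : 0 < n) (hj : j ≤ n) (t : ℕ → ℝ)
    (ht : ∀ k, t k = (2 * k + 1) * Real.pi / (2 * n)) :
    ∑ k ∈ range (2 * n), ((Real.sin (n * t k) *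
      (‖∑ p ∈ range n, Complex.exp (p * t k * Complex.I)‖ ^ 2 / (2 * n)) : ℝ) : ℂ) *
        Complex.exp (j * t k * Complex.I) = j * Complex.I := by
  have hn' : (n : ℂ) ≠ 0 := by exact_mod_cast hn.ne'
  have hterm : ∀ k, ((Real.sin (n * t k) *
      (‖∑ p ∈ range n, Complex.exp (p * t k * Complex.I)‖ ^ 2 / (2 * n)) : ℝ) : ℂ) *
        Complex.exp (j * t k * Complex.I) =
      Complex.I / (2 * n) * ∑ p ∈ range n, ∑ q ∈ range n,
        Complex.exp (((p + j - q - n : ℤ) : ℂ) * (t k : ℂ) * Complex.I) := by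
    intro k
    have hcos : Real.cos (n * t k) = 0 := by
      rw [Real.cos_eq_zero_iff]
      refine ⟨k, ?_⟩
      rw [ht]
      have : (n : ℝ) ≠ 0 := by exact_mod_cast hn.ne'
      push_cast
      field_simp
    have hsin : ((Real.sin (n * t k) : ℝ) : ℂ) =
        Complex.I * Complex.exp (-(n * t k) * Complex.I) := by
      rw [Complex.exp_mul_I, Complex.cos_neg, Complex.sin_neg]
      have : Complex.cos (n * t k) = 0 := by exact_mod_cast congrArg Complex.ofReal hcos
      rw [this]
      push_cast
      linear_combination Complex.sin (n * t k) * Complex.I_sq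
    have hnorm : ((‖∑ p ∈ range n, Complex.exp (p * t k * Complex.I)‖ ^ 2 : ℝ) : ℂ) =
        (∑ p ∈ range n, Complex.exp (p * t k * Complex.I)) *
          ∑ q ∈ range n, Complex.exp (-(q * t k * Complex.I)) := by
      push_cast
      rw [← Complex.mul_conj', map_sum]
      congr 1
      refine sum_congr rfl fun q _ => ?_
      rw [← Complex.exp_conj]
      simp
    have hexp : ∀ p q : ℕ,
        Complex.exp (((p + j - q - n : ℤ) : ℂ) * (t k : ℂ) * Complex.I) =
          Complex.exp (p * t k * Complex.I) * Complex.exp (-(q * t k * Complex.I)) *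
            (Complex.exp (-(n * t k) * Complex.I) * Complex.exp (j * t k * Complex.I)) := by
      intro p q
      simp_rw [← Complex.exp_add]
      congr 1
      push_cast
      ring
    simp_rw [hexp, ← sum_mul]
    rw [← sum_mul_sum, ← hnorm, Complex.ofReal_mul, hsin]
    push_cast
    ring
  have hsum : ∀ p ∈ range n, ∀ q ∈ range n, ∑ k ∈ range (2 * n),
      Complex.exp (((p + j - q - n : ℤ) : ℂ) * (t k : ℂ) * Complex.I) =
        if q + n = p + j then (2 * n : ℂ) else 0 := by
    intro p hp q hq
    rw [mem_range] at hp hq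
    split_ifs with h
    · have : (p + j - q - n : ℤ) = 0 := by omega
      simp [this]
    · simp_rw [ht]
      exact sum_exp_nodes_eq_zero hn (by omega) (by rw [abs_lt]; omega)
  have hcount : ∀ p ∈ range n,
      ∑ q ∈ range n, (if q + n = p + j then (2 * n : ℂ) else 0) =
        if n - j ≤ p then (2 * n : ℂ) else 0 := by
    intro p hp
    rw [mem_range] at hp
    split_ifs with h
    · rw [sum_eq_single (p + j - n)]
      · rw [if_pos (by omega)]
      · intro q _ hq
        rw [if_neg (by omega)]
      · intro hq
        rw [mem_range] at hq
        omega
    · refine sum_eq_zero fun q _ => if_neg (by omega)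
  simp_rw [hterm, ← mul_sum]
  rw [sum_comm]
  simp_rw [sum_comm (s := range (2 * n))]
  rw [sum_congr rfl fun p hp => (sum_congr rfl (hsum p hp)).trans (hcount p hp), ← sum_filter]
  have hfilter : (range n).filter (fun p => n - j ≤ p) = Ico (n - j) n := by
    ext p
    simp [and_comm]
  rw [hfilter, sum_const, Nat.card_Ico, Nat.sub_sub_self hj, nsmul_eq_mul]
  field_simp

open Finset in
/-- M. Riesz's interpolation formula: the derivative of a trigonometric polynomial of degree at
most `n` is a combination of `2n` translates, with coefficients of total mass `n`. -/
theorem exists_riesz_interpolation {n : ℕ} (hn : 0 < n) :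
    ∃ c t : ℕ → ℝ, ∑ k ∈ range (2 * n), |c k| = n ∧
      ∀ j ≤ n, ∑ k ∈ range (2 * n), c k * Real.cos (j * t k) = 0 ∧
        ∑ k ∈ range (2 * n), c k * Real.sin (j * t k) = j := by
  set t : ℕ → ℝ := fun k => (2 * k + 1) * Real.pi / (2 * n) with ht
  set w : ℕ → ℝ := fun k =>
    ‖∑ p ∈ range n, Complex.exp (p * t k * Complex.I)‖ ^ 2 / (2 * n) with hw
  have key : ∀ j ≤ n, ∑ k ∈ range (2 * n), Real.sin (n * t k) * w k * Real.cos (j * t k) = 0 ∧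
      ∑ k ∈ range (2 * n), Real.sin (n * t k) * w k * Real.sin (j * t k) = j := by
    intro j hj
    have h := riesz_interpolation_exp hn hj t (fun _ => rfl)
    have hc : ∀ k, (j * t k * Complex.I : ℂ) = ((j * t k : ℝ) : ℂ) * Complex.I := by
      intro k
      push_cast
      rfl
    simp_rw [hc] at h
    constructor
    · have hre := congrArg Complex.re h
      simp_rw [Complex.re_sum, Complex.re_ofReal_mul, Complex.exp_ofReal_mul_I_re] at hre
      simpa using hre
    · have him := congrArg Complex.im h
      simp_rw [Complex.im_sum, Complex.im_ofReal_mul, Complex.exp_ofReal_mul_I_im] at him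
      simpa using him
  refine ⟨fun k => Real.sin (n * t k) * w k, t, ?_, key⟩
  refine Eq.trans (sum_congr rfl fun k _ => ?_) (key n le_rfl).2
  have hcos : Real.cos (n * t k) = 0 := by
    rw [Real.cos_eq_zero_iff]
    refine ⟨k, ?_⟩
    have : (n : ℝ) ≠ 0 := by exact_mod_cast hn.ne'
    simp only [ht]
    push_cast
    field_simp
  have hw0 : 0 ≤ w k := by positivity
  have hsq : Real.sin (n * t k) ^ 2 = 1 := by
    have := Real.sin_sq_add_cos_sq (n * t k)
    rw [hcos] at this
    linarith
  have habs : |Real.sin (n * t k)| = 1 := by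
    rw [← sq_eq_sq₀ (abs_nonneg _) zero_le_one, sq_abs, hsq, one_pow]
  rw [abs_mul, habs, abs_of_nonneg hw0]
  linear_combination -w k * hsq

/-- **Lemma 3.3** (Bernstein's inequality for nonnegative trigonometric polynomials):
if `T(t) = a₀ + Σ_{j=1}^n (a_j cos jt + b_j sin jt)` is a real trigonometric polynomial of
degree at most `n` that is nonnegative on `ℝ`, then `max |T'| ≤ (n/2) · max T`. -/
theorem bernstein_nonneg_trig_poly (n : ℕ) (T : ℝ → ℝ) (a b : ℕ → ℝ)
    (hT : ∀ t : ℝ, T t =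
      a 0 + ∑ j ∈ Finset.Icc 1 n, (a j * Real.cos (j * t) + b j * Real.sin (j * t)))
    (hTnonneg : ∀ t : ℝ, 0 ≤ T t) :
    ∀ τ : ℝ, |deriv T τ| ≤ (n / 2 : ℝ) * ⨆ t : ℝ, T t := by
  intro τ
  have hbdd : BddAbove (Set.range T) := by
    refine ⟨a 0 + ∑ j ∈ Finset.Icc 1 n, (|a j| + |b j|), ?_⟩
    rintro _ ⟨t, rfl⟩
    rw [hT]
    gcongr with j
    · refine (le_abs_self _).trans ?_
      rw [abs_mul]
      exact mul_le_of_le_one_right (abs_nonneg _) (Real.abs_cos_le_one _)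
    · refine (le_abs_self _).trans ?_
      rw [abs_mul]
      exact mul_le_of_le_one_right (abs_nonneg _) (Real.abs_sin_le_one _)
  set M := ⨆ t : ℝ, T t
  have hM : ∀ t, T t ≤ M := le_ciSup hbdd
  have hderiv : deriv T τ =
      ∑ j ∈ Finset.Icc 1 n, (b j * Real.cos (j * τ) - a j * Real.sin (j * τ)) * j := by
    rw [funext hT]
    refine HasDerivAt.deriv (HasDerivAt.const_add _ (HasDerivAt.fun_sum fun j _ => ?_))
    have hlin : HasDerivAt (fun t : ℝ => (j : ℝ) * t) j τ := by
      simpa using (hasDerivAt_id τ).const_mul (j : ℝ)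
    convert (hlin.cos.const_mul (a j)).fun_add (hlin.sin.const_mul (b j)) using 1
    ring
  obtain rfl | hn := Nat.eq_zero_or_pos n
  · simp [hderiv]
  obtain ⟨c, t, hc, hct⟩ := exists_riesz_interpolation hn
  have hc0 : ∑ k ∈ Finset.range (2 * n), c k = 0 := by simpa using (hct 0 (Nat.zero_le n)).1
  have hformula : deriv T τ = ∑ k ∈ Finset.range (2 * n), c k * (T (τ + t k) - M / 2) := by
    have hexpand : ∀ k, c k * (T (τ + t k) - M / 2) = (a 0 - M / 2) * c k +
        ∑ j ∈ Finset.Icc 1 n,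
          ((a j * Real.cos (j * τ) + b j * Real.sin (j * τ)) * (c k * Real.cos (j * t k)) +
            (b j * Real.cos (j * τ) - a j * Real.sin (j * τ)) *
              (c k * Real.sin (j * t k))) := by
      intro k
      rw [hT, add_sub_right_comm, mul_add, Finset.mul_sum, mul_comm]
      congr 1
      refine Finset.sum_congr rfl fun j _ => ?_
      rw [mul_add (j : ℝ), Real.cos_add, Real.sin_add]
      ring
    simp_rw [hexpand]
    rw [Finset.sum_add_distrib, ← Finset.mul_sum, hc0, mul_zero, zero_add, Finset.sum_comm,
      hderiv]
    refine Finset.sum_congr rfl fun j hj => ?_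
    obtain ⟨hcos, hsin⟩ := hct j (Finset.mem_Icc.mp hj).2
    rw [Finset.sum_add_distrib, ← Finset.mul_sum, ← Finset.mul_sum, hcos, hsin]
    ring
  calc |deriv T τ| ≤ ∑ k ∈ Finset.range (2 * n), |c k| * (M / 2) := by
        rw [hformula]
        refine (Finset.abs_sum_le_sum_abs _ _).trans (Finset.sum_le_sum fun k _ => ?_)
        rw [abs_mul]
        gcongr
        rw [abs_le]
        constructor <;> linarith [hTnonneg (τ + t k), hM (τ + t k)]
    _ = n / 2 * M := by
        rw [← Finset.sum_mul, hc]
        ring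
end

section
/- Let P_k and Q_k be the Rudin-Shapiro polynomials of degree n-1 with n := 2^k. For every k ≥ 1, the polynomial P_k has exactly one real zero, and the polynomial Q_k has exactly one real zero. -/
open Polynomial MeasureTheory

/-- The pair of Rudin–Shapiro polynomials `(P_k, Q_k)`. -/
noncomputable def RS : ℕ → Polynomial ℂ × Polynomial ℂ
  | 0 => (1, 1)
  | k + 1 =>
      let p := RS k
      (p.1 + X ^ (2 ^ k) * p.2, p.1 - X ^ (2 ^ k) * p.2)

/-- The Rudin–Shapiro polynomial `P_k`, of degree `2^k - 1`. -/
noncomputable def RSP (k : ℕ) : Polynomial ℂ := (RS k).1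

/-- The Rudin–Shapiro polynomial `Q_k`, of degree `2^k - 1`. -/
noncomputable def RSQ (k : ℕ) : Polynomial ℂ := (RS k).2

/-- The values `(P_k(x), Q_k(x))` of the Rudin–Shapiro polynomials at a real point. -/
def realRS : ℕ → ℝ → ℝ × ℝ
  | 0, _ => (1, 1)
  | k + 1, x =>
      ((realRS k x).1 + x ^ (2 ^ k) * (realRS k x).2,
        (realRS k x).1 - x ^ (2 ^ k) * (realRS k x).2)

lemma RS_eval_ofReal (k : ℕ) (x : ℝ) :
    (RSP k).eval (x : ℂ) = ((realRS k x).1 : ℂ) ∧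
      (RSQ k).eval (x : ℂ) = ((realRS k x).2 : ℂ) := by
  induction k with
  | zero => simp [RSP, RSQ, RS, realRS]
  | succ k ih =>
    obtain ⟨hP, hQ⟩ := ih
    simp only [RSP, RSQ] at hP hQ
    simp [RSP, RSQ, RS, realRS, hP, hQ]

/-- The operation taking `P_k` to `P_{k+1}`, see `realRS_succ_eq_fold`. -/
def fold (f : ℝ → ℝ) (x : ℝ) : ℝ := f (x ^ 2) + x * f (-x ^ 2)

lemma realRS_succ_eq_fold (k : ℕ) (x : ℝ) :
    (realRS (k + 2) x).1 = fold (fun y => (realRS (k + 1) y).1) x ∧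
      (realRS (k + 2) x).2 = fold (fun y => (realRS (k + 1) y).2) x := by
  induction k with
  | zero => simp only [realRS, fold]; constructor <;> ring
  | succ k ih =>
    obtain ⟨hP, hQ⟩ := ih
    have hsq : x ^ 2 ^ (k + 2) = (x ^ 2) ^ 2 ^ (k + 1) := by rw [← pow_mul]; congr 1; ring
    have hneg : (-x ^ 2) ^ 2 ^ (k + 1) = (x ^ 2) ^ 2 ^ (k + 1) :=
      Even.neg_pow (even_two.pow_of_ne_zero k.succ_ne_zero) _
    simp only [fold] at hP hQ ⊢
    rw [realRS, realRS.eq_2 (x ^ 2) (k + 1), realRS.eq_2 (-x ^ 2) (k + 1)]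
    simp only [hP, hQ, hsq, hneg]
    constructor <;> ring

lemma realRS_reciprocal (k : ℕ) {x : ℝ} (hx : x ≠ 0) :
    x ^ 2 ^ (k + 1) * (realRS (k + 1) x⁻¹).1 = (-1) ^ k * x * (realRS (k + 1) (-x)).2 ∧
      x ^ 2 ^ (k + 1) * (realRS (k + 1) x⁻¹).2 =
        (-1) ^ (k + 1) * x * (realRS (k + 1) (-x)).1 := by
  induction k with
  | zero => simp only [realRS]; constructor <;> simp <;> field_simp <;> ring
  | succ k ih =>
    obtain ⟨hP, hQ⟩ := ih
    have hneg : (-x) ^ 2 ^ (k + 1) = x ^ 2 ^ (k + 1) :=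
      Even.neg_pow (even_two.pow_of_ne_zero k.succ_ne_zero) _
    have hdbl : x ^ 2 ^ (k + 2) = x ^ 2 ^ (k + 1) * x ^ 2 ^ (k + 1) := by
      rw [← pow_add]; congr 1; ring
    have hinv : x ^ 2 ^ (k + 1) * x⁻¹ ^ 2 ^ (k + 1) = 1 := by
      rw [← mul_pow, mul_inv_cancel₀ hx, one_pow]
    rw [realRS, realRS.eq_2 (-x) (k + 1)]
    simp only [hneg, hdbl]
    generalize x ^ 2 ^ (k + 1) = a at *
    generalize x⁻¹ ^ 2 ^ (k + 1) = b at *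
    constructor
    · linear_combination a * hP + a * b * hQ +
        (-1) ^ (k + 1) * x * (realRS (k + 1) (-x)).1 * hinv
    · linear_combination a * hP - a * b * hQ -
        (-1) ^ (k + 1) * x * (realRS (k + 1) (-x)).1 * hinv

/-- The properties of `P_k` for odd `k` that are preserved by folding twice. The field `cross` says
that `fold f x / fold f (-x)` is strictly decreasing on `[1, ∞)` as long as it is nonnegative. -/
structure OddProfile (f : ℝ → ℝ) : Prop where
  pos : ∀ x, 0 ≤ x → 0 < f x
  neg_one : f (-1) = 0
  neg_pos : ∀ x, 0 ≤ x → x < 1 → 0 < f (-x)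
  neg_le : ∀ x, 0 ≤ x → x < 1 → f (-x) ≤ f x
  neg_neg : ∀ x, 1 < x → f (-x) < 0
  cross : ∀ x y, 1 ≤ x → x < y → 0 ≤ fold f y →
    fold f y * fold f (-x) < fold f x * fold f (-y)
  fold_two : fold f 2 < 0

lemma fold_neg (f : ℝ → ℝ) (x : ℝ) : fold f (-x) = f (x ^ 2) - x * f (-x ^ 2) := by
  simp only [fold, neg_sq]; ring

namespace OddProfile

variable {f : ℝ → ℝ}

lemma neg_nonpos (h : OddProfile f) {x : ℝ} (hx : 1 ≤ x) : f (-x) ≤ 0 := by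
  rcases hx.eq_or_lt with rfl | hx
  · exact h.neg_one.le
  · exact (h.neg_neg x hx).le

lemma fold_neg_pos (h : OddProfile f) {x : ℝ} (hx : 0 ≤ x) : 0 < fold f (-x) := by
  rw [fold_neg]
  have hp := h.pos (x ^ 2) (sq_nonneg x)
  rcases lt_or_ge x 1 with h1 | h1
  · have hx2 : x ^ 2 < 1 := by nlinarith
    nlinarith [h.neg_le _ (sq_nonneg x) hx2, h.neg_pos _ (sq_nonneg x) hx2]
  · nlinarith [h.neg_nonpos (show 1 ≤ x ^ 2 by nlinarith)]

lemma fold_neg_le (h : OddProfile f) {x : ℝ} (hx : 0 ≤ x) (h1 : x ≤ 1) :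
    fold f (-x) ≤ fold f x := by
  rw [fold_neg, fold]
  rcases h1.eq_or_lt with rfl | h1
  · simp [h.neg_one]
  · nlinarith [h.neg_pos (x ^ 2) (sq_nonneg x) (by nlinarith)]

lemma fold_lt_neg (h : OddProfile f) {x : ℝ} (h1 : 1 < x) : fold f x < fold f (-x) := by
  rw [fold_neg, fold]
  nlinarith [h.neg_neg (x ^ 2) (by nlinarith)]

lemma fold_add_fold_neg_pos (h : OddProfile f) (x : ℝ) : 0 < fold f x + fold f (-x) := by
  rw [fold_neg, fold]
  linarith [h.pos (x ^ 2) (sq_nonneg x)]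

/-- A cross-multiplied form of the monotonicity of `-x * f (-x ^ 2) / f (x ^ 2)`. -/
lemma cross_of_lt {x y : ℝ} (hx : 1 ≤ x) (hxy : x < y) (hfx : 0 < f (x ^ 2))
    (hfy : f (-y ^ 2) ≤ 0) (hlt : f (-y ^ 2) * f (x ^ 2) < f (-x ^ 2) * f (y ^ 2)) :
    fold f y * fold f (-x) < fold f x * fold f (-y) := by
  simp only [fold_neg]
  simp only [fold]
  have h1 := mul_nonneg (sub_nonneg.2 hxy.le) (mul_nonneg (neg_nonneg.2 hfy) hfx.le)
  have h2 := mul_pos (zero_lt_one.trans_le hx) (sub_pos.2 hlt)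
  nlinarith

lemma one_add_id : OddProfile (fun x => 1 + x) where
  pos x hx := by linarith
  neg_one := by norm_num
  neg_pos x _ h1 := by linarith
  neg_le x hx _ := by linarith
  neg_neg x h1 := by linarith
  cross x y hx hxy _ :=
    cross_of_lt hx hxy (by positivity) (by nlinarith) (by nlinarith)
  fold_two := by norm_num [fold]

lemma fold_fold (h : OddProfile f) : OddProfile (fold (fold f)) := by
  have hneg_neg : ∀ x, 1 < x → fold (fold f) (-x) < 0 := fun x h1 => by
    rw [fold_neg]
    have hx2 : 1 < x ^ 2 := by nlinarith
    nlinarith [h.fold_lt_neg hx2, h.fold_neg_pos (sq_nonneg x)]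
  have hpos : ∀ x, 0 ≤ x → 0 < fold (fold f) x := fun x hx => by
    rw [fold]
    have hn := h.fold_neg_pos (sq_nonneg x)
    rcases le_or_gt x 1 with h1 | h1
    · have hle := h.fold_neg_le (sq_nonneg x) (by nlinarith)
      nlinarith
    · nlinarith [h.fold_add_fold_neg_pos (x ^ 2)]
  refine ⟨hpos, ?_, ?_, ?_, hneg_neg, ?_, ?_⟩
  · simp [fold, h.neg_one]
  · intro x hx h1
    rw [fold_neg]
    have hle := h.fold_neg_le (sq_nonneg x) (by nlinarith)
    nlinarith [h.fold_neg_pos (sq_nonneg x)]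
  · intro x hx _
    rw [fold_neg, fold.eq_1 (fold f)]
    nlinarith [h.fold_neg_pos (sq_nonneg x)]
  · intro x y hx hxy hy
    have hy1 : 1 < y := hx.trans_lt hxy
    have hx2 : 1 ≤ x ^ 2 := by nlinarith
    have hy2 : 1 < y ^ 2 := by nlinarith
    have hsq : x ^ 2 < y ^ 2 := by nlinarith
    have hB := h.fold_neg_pos (sq_nonneg (x ^ 2))
    have hD := h.fold_neg_pos (sq_nonneg (y ^ 2))
    have hC : 0 ≤ fold f ((y ^ 2) ^ 2) := by
      simp only [fold.eq_1 (fold (fold f)), fold_neg (fold f), fold.eq_1 (fold f)] at hy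
      by_contra! hC
      nlinarith [mul_pos (mul_pos (sub_pos.2 hy1) (zero_lt_one.trans hy2)) hD]
    have hAD := h.cross _ _ (show 1 ≤ (x ^ 2) ^ 2 by nlinarith)
      (show (x ^ 2) ^ 2 < (y ^ 2) ^ 2 by nlinarith) hC
    refine cross_of_lt hx hxy (hpos _ (sq_nonneg x)) (hneg_neg _ hy2).le ?_
    rw [fold_neg (fold f) (x ^ 2), fold_neg (fold f) (y ^ 2), fold.eq_1 (fold f) (x ^ 2), fold.eq_1 (fold f) (y ^ 2)]
    have h1 := mul_pos (zero_lt_one.trans hy2) (sub_pos.2 hAD)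
    have h2 := mul_nonneg (sub_pos.2 hsq).le (mul_nonneg hC hB.le)
    nlinarith
  · have h16 : fold f 16 < 0 := by
      by_contra! h16
      have := h.cross 2 16 (by norm_num) (by norm_num) h16
      nlinarith [h.fold_two, h.fold_neg_pos (show (0 : ℝ) ≤ 2 by norm_num),
        h.fold_neg_pos (show (0 : ℝ) ≤ 16 by norm_num)]
    have hn := h.fold_neg_pos (show (0 : ℝ) ≤ 16 by norm_num)
    rw [fold, fold_neg, fold.eq_1 (fold f)]
    norm_num
    linarith

lemma existsUnique_zero (h : OddProfile f) : ∃! x, f x = 0 := by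
  refine ⟨-1, h.neg_one, fun x hx => ?_⟩
  have hx0 : x < 0 := by
    by_contra! hx0
    exact (h.pos x hx0).ne' hx
  rcases lt_trichotomy (-x) 1 with h1 | h1 | h1
  · have := h.neg_pos (-x) (by linarith) h1
    rw [_root_.neg_neg] at this
    exact absurd hx this.ne'
  · linarith
  · have := h.neg_neg (-x) h1
    rw [_root_.neg_neg] at this
    exact absurd hx this.ne

lemma existsUnique_zero_fold (h : OddProfile f) (hf : Continuous f) : ∃! x, fold f x = 0 := by
  have hcont : Continuous (fold f) := by unfold fold; fun_prop
  have hgt : ∀ x, fold f x = 0 → 1 < x := fun x hx => by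
    by_contra! h1
    rcases le_total 0 x with hx0 | hx0
    · linarith [h.fold_neg_pos hx0, h.fold_neg_le hx0 h1]
    · have := h.fold_neg_pos (neg_nonneg.2 hx0)
      rw [_root_.neg_neg] at this
      exact this.ne' hx
  have hlt : ∀ x y, fold f x = 0 → fold f y = 0 → ¬ x < y := fun x y hx hy hxy => by
    have := h.cross x y (hgt x hx).le hxy hy.ge
    simp [hx, hy] at this
  have hone : 0 ≤ fold f 1 :=
    (h.fold_neg_pos zero_le_one).le.trans (h.fold_neg_le zero_le_one le_rfl)
  obtain ⟨x, -, hx⟩ :=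
    intermediate_value_Icc' (one_le_two (α := ℝ)) hcont.continuousOn ⟨h.fold_two.le, hone⟩
  exact ⟨x, hx, fun y hy => le_antisymm (not_lt.1 (hlt x y hx hy)) (not_lt.1 (hlt y x hy hx))⟩

end OddProfile

lemma continuous_realRS (k : ℕ) : Continuous (realRS k) := by
  induction k with
  | zero => exact continuous_const
  | succ k ih =>
    rw [funext fun x => realRS.eq_2 x k]
    fun_prop

lemma realRS_fst_succ (k : ℕ) :
    (fun x => (realRS (k + 2) x).1) = fold (fun x => (realRS (k + 1) x).1) :=
  funext fun x => (realRS_succ_eq_fold k x).1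

lemma oddProfile_realRS (m : ℕ) : OddProfile (fun x => (realRS (2 * m + 1) x).1) := by
  induction m with
  | zero => simpa [realRS] using OddProfile.one_add_id
  | succ m ih =>
    have := ih.fold_fold
    rwa [← realRS_fst_succ, ← realRS_fst_succ] at this

lemma existsUnique_realRS_fst_zero (k : ℕ) : ∃! x, (realRS (k + 1) x).1 = 0 := by
  obtain ⟨m, rfl | rfl⟩ := k.even_or_odd'
  · exact (oddProfile_realRS m).existsUnique_zero
  · have := (oddProfile_realRS m).existsUnique_zero_fold (continuous_realRS _).fst
    rwa [← realRS_fst_succ] at this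

lemma realRS_zero_right (k : ℕ) : realRS (k + 1) 0 = (1, 1) := by
  induction k with
  | zero => simp [realRS]
  | succ k ih => rw [realRS, ih]; simp

lemma realRS_snd_eq_zero_iff (k : ℕ) {x : ℝ} (hx : x ≠ 0) :
    (realRS (k + 1) x).2 = 0 ↔ (realRS (k + 1) (-x)⁻¹).1 = 0 := by
  have h := (realRS_reciprocal k (neg_ne_zero.2 hx)).1
  rw [neg_neg] at h
  have ha : (-x) ^ 2 ^ (k + 1) ≠ 0 := pow_ne_zero _ (neg_ne_zero.2 hx)
  have hb : (-1) ^ k * -x ≠ 0 := by simp [hx]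
  rw [← mul_eq_zero_iff_left hb, ← h, mul_eq_zero_iff_left ha]

lemma existsUnique_realRS_snd_zero (k : ℕ) : ∃! x, (realRS (k + 1) x).2 = 0 := by
  obtain ⟨r, hr, huniq⟩ := existsUnique_realRS_fst_zero k
  have hr0 : r ≠ 0 := by rintro rfl; simp [realRS_zero_right] at hr
  refine ⟨-r⁻¹, ?_, fun x hx => ?_⟩
  · exact (realRS_snd_eq_zero_iff k (by simpa using hr0)).2 (by simpa using hr)
  · have hx0 : x ≠ 0 := by rintro rfl; simp [realRS_zero_right] at hx
    rw [← huniq _ ((realRS_snd_eq_zero_iff k hx0).1 hx)]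
    simp

/-- **Brillhart**: for `k ≥ 1`, each of the Rudin–Shapiro polynomials `P_k` and `Q_k` has
exactly one real zero. -/
theorem rudin_shapiro_exactly_one_real_zero (k : ℕ) (hk : 1 ≤ k) :
    (∃! x : ℝ, (RSP k).eval (x : ℂ) = 0) ∧ (∃! x : ℝ, (RSQ k).eval (x : ℂ) = 0) := by
  obtain ⟨k, rfl⟩ := Nat.exists_eq_add_of_le' hk
  simp only [RS_eval_ofReal, Complex.ofReal_eq_zero]
  exact ⟨existsUnique_realRS_fst_zero k, existsUnique_realRS_snd_zero k⟩
end
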